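/- Consider the instance with nine chores e_1,…,e_9 and three agents R, C, U with additive cost functions given item by item (listed in the order e_1,…,e_9) by: v^R = (0, 9, 9, 12, 3, 3, 4, 7, 7); v^C = (0, 17/2, 15/2, 51/4, 13/4, 3, 21/4, 25/4, 15/2); v^U = (0, 38/5, 38/5, 57/5, 23/5, 19/5, 19/5, 38/5, 38/5). Then mmS^R = mmS^C = 18 and PS^U = 18, and in every allocation of the nine chores into three bundles (A_R, A_C, A_U), at least one of the following holds: v^R(A_R) ≥ 19, or v^C(A_C) ≥ 19, or v^U(A_U) ≥ 19. -/

import Mathlib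

/-- The total value of the bundle given to agent `j` by allocation/partition `f`. -/
noncomputable def bundleVal {M : Type*} [Fintype M] {n : ℕ} (v : M → ℝ)
    (f : M → Fin n) (j : Fin n) : ℝ :=
  ∑ e ∈ Finset.univ.filter (fun e => f e = j), v e

/-- The maximin share: max over partitions into `n` bundles of the min bundle value. -/
noncomputable def MMS {M : Type*} [Fintype M] [DecidableEq M] (n : ℕ) [NeZero n]
    (v : M → ℝ) : ℝ :=
  Finset.univ.sup' Finset.univ_nonempty fun f : M → Fin n =>
    Finset.univ.inf' Finset.univ_nonempty fun j => bundleVal v f j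

/-- The minimax share: min over partitions into `n` bundles of the max bundle value. -/
noncomputable def mmS {M : Type*} [Fintype M] [DecidableEq M] (n : ℕ) [NeZero n]
    (v : M → ℝ) : ℝ :=
  Finset.univ.inf' Finset.univ_nonempty fun f : M → Fin n =>
    Finset.univ.sup' Finset.univ_nonempty fun j => bundleVal v f j

/-- The proportional share: total value divided by the number `n` of agents. -/
noncomputable def PS {M : Type*} [Fintype M] (n : ℕ) (v : M → ℝ) : ℝ :=
  (∑ e, v e) / n

/-- Cost function of agent R in the negative example for chores. -/
noncomputable def vR : Fin 9 → ℝ := ![0, 9, 9, 12, 3, 3, 4, 7, 7]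

/-- Cost function of agent C in the negative example for chores. -/
noncomputable def vC : Fin 9 → ℝ := ![0, 17/2, 15/2, 51/4, 13/4, 3, 21/4, 25/4, 15/2]

/-- Cost function of agent U in the negative example for chores. -/
noncomputable def vU : Fin 9 → ℝ := ![0, 38/5, 38/5, 57/5, 23/5, 19/5, 19/5, 38/5, 38/5]

/-- The proportional share is a lower bound for the minimax share. -/
theorem PS_le_mmS {M : Type*} [Fintype M] [DecidableEq M] (n : ℕ) [NeZero n] (v : M → ℝ) :
    PS n v ≤ mmS n v := by
  refine Finset.le_inf' _ _ fun f _ => ?_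
  have hn : (0 : ℝ) < n := Nat.cast_pos.mpr (NeZero.pos n)
  rw [PS, div_le_iff₀ hn, ← Finset.sum_fiberwise Finset.univ f v]
  refine (Finset.sum_le_card_nsmul Finset.univ (fun j => bundleVal v f j)
    (Finset.univ.sup' Finset.univ_nonempty fun j => bundleVal v f j) fun j hj =>
      Finset.le_sup' (fun j => bundleVal v f j) hj).trans_eq ?_
  rw [Finset.card_univ, Fintype.card_fin, nsmul_eq_mul, mul_comm]

/-- A partition all of whose bundles cost at most `c` bounds the minimax share by `c`. -/
theorem mmS_le_of_forall_bundleVal_le {M : Type*} [Fintype M] [DecidableEq M] {n : ℕ} [NeZero n]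
    {v : M → ℝ} {c : ℝ} (f : M → Fin n) (h : ∀ j, bundleVal v f j ≤ c) : mmS n v ≤ c :=
  (Finset.inf'_le _ (Finset.mem_univ f)).trans (Finset.sup'_le _ _ fun j _ => h j)

/-- A pruned search deciding whether, starting from loads `a`, `b`, `c`, every way of distributing
the items of the list (given by their costs to the three agents) gives some agent a load
of at least `t`. -/
def forcesLoad (t : ℕ) : List (ℕ × ℕ × ℕ) → ℕ → ℕ → ℕ → Bool
  | [], a, b, c => t.ble a || t.ble b || t.ble c
  | w :: l, a, b, c => (t.ble a || t.ble b || t.ble c) ||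
      (forcesLoad t l (a + w.1) b c && forcesLoad t l a (b + w.2.1) c &&
        forcesLoad t l a b (c + w.2.2))

theorem exists_load_ge_of_forcesLoad {t : ℕ} (l : List (ℕ × ℕ × ℕ)) (a b c : ℕ)
    (h : forcesLoad t l a b c = true) (A : Fin l.length → Fin 3) :
    t ≤ a + ∑ i, (if A i = 0 then (l.get i).1 else 0) ∨
    t ≤ b + ∑ i, (if A i = 1 then (l.get i).2.1 else 0) ∨
    t ≤ c + ∑ i, (if A i = 2 then (l.get i).2.2 else 0) := by
  induction l generalizing a b c with
  | nil =>
    simp only [forcesLoad, Bool.or_eq_true, Nat.ble_eq] at h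
    omega
  | cons w l ih =>
    simp only [forcesLoad, Bool.or_eq_true, Bool.and_eq_true, Nat.ble_eq] at h
    rcases h with h | ⟨⟨h₀, h₁⟩, h₂⟩
    · omega
    · simp only [List.length_cons, Fin.sum_univ_succ, List.get_cons_zero, List.get_cons_succ']
      have hA : A 0 = 0 ∨ A 0 = 1 ∨ A 0 = 2 := by
        generalize A 0 = x
        fin_cases x <;> simp
      rcases hA with hA | hA | hA
      · have := ih _ _ _ h₀ fun i => A i.succ
        simpa [hA, add_assoc] using this
      · have := ih _ _ _ h₁ fun i => A i.succ
        simpa [hA, add_assoc] using this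
      · have := ih _ _ _ h₂ fun i => A i.succ
        simpa [hA, add_assoc] using this

theorem mul_bundleVal_eq_natCast {M : Type*} [Fintype M] {n : ℕ} {v : M → ℝ} {w : M → ℕ} {q : ℝ}
    (h : ∀ e, q * v e = w e) (f : M → Fin n) (j : Fin n) :
    q * bundleVal v f j = ((∑ e, if f e = j then w e else 0 : ℕ) : ℝ) := by
  simp [bundleVal, ← Finset.sum_filter, Finset.mul_sum, h]

/-- The costs of the nine chores to the agents R, C, U, multiplied by 20. -/
def scaledCosts : List (ℕ × ℕ × ℕ) :=
  [(0, 0, 0), (180, 170, 152), (180, 150, 152), (240, 255, 228), (60, 65, 92), (60, 60, 76),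
    (80, 105, 76), (140, 125, 152), (140, 150, 152)]

theorem forcesLoad_scaledCosts : forcesLoad 380 scaledCosts 0 0 0 = true := by
  decide +kernel

/-- In the nine-chore instance with cost functions vR, vC, vU, the minimax
shares of R and C equal 18, the proportional share of U equals 18, and in every
allocation (agent R = 0, C = 1, U = 2) some agent gets a bundle of cost at least 19. -/
theorem negative_example_chores :
    mmS 3 vR = 18 ∧ mmS 3 vC = 18 ∧ PS 3 vU = 18 ∧
    ∀ A : Fin 9 → Fin 3,
      19 ≤ bundleVal vR A 0 ∨ 19 ≤ bundleVal vC A 1 ∨ 19 ≤ bundleVal vU A 2 := by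
  have sumR : ∑ e, vR e = 54 := by simp [vR, Fin.sum_univ_succ]; norm_num
  have sumC : ∑ e, vC e = 54 := by simp [vC, Fin.sum_univ_succ]; norm_num
  have sumU : ∑ e, vU e = 54 := by simp [vU, Fin.sum_univ_succ]; norm_num
  refine ⟨le_antisymm ?_ ?_, le_antisymm ?_ ?_, ?_, fun A => ?_⟩
  · refine mmS_le_of_forall_bundleVal_le ![0, 0, 0, 1, 1, 1, 2, 2, 2] fun j => ?_
    fin_cases j <;> simp [bundleVal, Finset.sum_filter, vR, Fin.sum_univ_succ] <;> norm_num
  · refine le_trans ?_ (PS_le_mmS 3 vR)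
    norm_num [PS, sumR]
  · refine mmS_le_of_forall_bundleVal_le ![0, 1, 2, 0, 1, 2, 0, 1, 2] fun j => ?_
    fin_cases j <;> simp [bundleVal, Finset.sum_filter, vC, Fin.sum_univ_succ] <;> norm_num
  · refine le_trans ?_ (PS_le_mmS 3 vC)
    norm_num [PS, sumC]
  · norm_num [PS, sumU]
  · have hR := mul_bundleVal_eq_natCast (v := vR) (q := 20) (w := fun e => (scaledCosts.get e).1)
      (fun e => by fin_cases e <;> simp [vR, scaledCosts] <;> norm_num) A 0
    have hC := mul_bundleVal_eq_natCast (v := vC) (q := 20) (w := fun e => (scaledCosts.get e).2.1)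
      (fun e => by fin_cases e <;> simp [vC, scaledCosts] <;> norm_num) A 1
    have hU := mul_bundleVal_eq_natCast (v := vU) (q := 20) (w := fun e => (scaledCosts.get e).2.2)
      (fun e => by fin_cases e <;> simp [vU, scaledCosts] <;> norm_num) A 2
    rcases exists_load_ge_of_forcesLoad scaledCosts 0 0 0 forcesLoad_scaledCosts A with h | h | h
    · left
      have h' : ((380 : ℕ) : ℝ) ≤ 20 * bundleVal vR A 0 := by
        rw [hR]; exact Nat.cast_le.mpr (h.trans_eq (zero_add _))
      norm_num at h'; linarith
    · right; left
      have h' : ((380 : ℕ) : ℝ) ≤ 20 * bundleVal vC A 1 := by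
        rw [hC]; exact Nat.cast_le.mpr (h.trans_eq (zero_add _))
      norm_num at h'; linarith
    · right; right
      have h' : ((380 : ℕ) : ℝ) ≤ 20 * bundleVal vU A 2 := by
        rw [hU]; exact Nat.cast_le.mpr (h.trans_eq (zero_add _))
      norm_num at h'; linarith
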